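/- The Delaunay transformation F : D → ℝ² × ℝ², F(L,ℓ,G,g) = (q,p), is symplectic: it is C^∞ on D, and its Jacobian DF(z) at every z ∈ D transforms the canonical symplectic form dp₁∧dq₁ + dp₂∧dq₂ of the (q,p)-variables into dL∧dℓ + dG∧dg; equivalently, (DF(z))ᵀ · Ω · DF(z) = Ω₀ for all z ∈ D, where Ω is the matrix of dp₁∧dq₁ + dp₂∧dq₂ in the coordinates (q₁,q₂,p₁,p₂) and Ω₀ is the matrix of dL∧dℓ + dG∧dg in the coordinates (L,ℓ,G,g). -/

import Mathlib

/-- The Delaunay transformation `F(L,ℓ,G,g) = (q,p)`, where the coordinates of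
`z : Fin 4 → ℝ` are `(L,ℓ,G,g) = (z 0, z 1, z 2, z 3)` and the output
coordinates are `(q₁,q₂,p₁,p₂)`. -/
noncomputable def delaunayF (U : ℝ → ℝ → ℝ) (z : Fin 4 → ℝ) : Fin 4 → ℝ :=
  let L := z 0
  let ℓ := z 1
  let G := z 2
  let g := z 3
  let e := Real.sqrt (1 - G ^ 2 / L ^ 2)
  let u := U e ℓ
  let r := L ^ 2 * (1 - e * Real.cos u)
  let cv := (Real.cos u - e) / (1 - e * Real.cos u)
  let sv := Real.sqrt (1 - e ^ 2) * Real.sin u / (1 - e * Real.cos u)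
  let er1 := cv * Real.cos g - sv * Real.sin g
  let er2 := sv * Real.cos g + cv * Real.sin g
  let rdot := e * Real.sin u / (L * (1 - e * Real.cos u))
  ![r * er1, r * er2, rdot * er1 - (G / r) * er2, rdot * er2 + (G / r) * er1]

/-- The Jacobian matrix of the Delaunay transformation at `z`. -/
noncomputable def delaunayJac (U : ℝ → ℝ → ℝ) (z : Fin 4 → ℝ) :
    Matrix (Fin 4) (Fin 4) ℝ :=
  Matrix.of fun i j => fderiv ℝ (delaunayF U) z (Pi.single j 1) i

/-- The matrix of the canonical symplectic form `dp₁∧dq₁ + dp₂∧dq₂` in the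
coordinates `(q₁,q₂,p₁,p₂)`. -/
def OmegaQP : Matrix (Fin 4) (Fin 4) ℝ :=
  !![0, 0, -1, 0; 0, 0, 0, -1; 1, 0, 0, 0; 0, 1, 0, 0]

/-- The matrix of the symplectic form `dL∧dℓ + dG∧dg` in the coordinates
`(L,ℓ,G,g)`. -/
def OmegaDel : Matrix (Fin 4) (Fin 4) ℝ :=
  !![0, 1, 0, 0; -1, 0, 0, 0; 0, 0, 0, 1; 0, 0, -1, 0]

lemma dl_cLu (L e η c s D : ℝ) (hL : L ≠ 0) (hη : η ≠ 0) (hD : D ≠ 0)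
    (hDe : D = 1 - e * c) (h1 : e ^ 2 + η ^ 2 = 1) (h2 : s ^ 2 + c ^ 2 = 1) :
    s / (L ^ 2 * D) * (- L ^ 2 * s) - (-(c - e) / (L * D ^ 2)) * (2 * L * (c - e))
       + (-η * c / (L ^ 2 * D)) * (L ^ 2 * η * c) - (-η * s / (L * D ^ 2)) * (2 * L * η * s) = D := by
  field_simp
  clear hL hη hD
  subst hDe
  have h1' : η ^ 2 = 1 - e ^ 2 := by linarith
  have h2' : s ^ 2 = 1 - c ^ 2 := by linarith
  clear h1 h2
  grind
lemma dl_cLe (L e η c s D : ℝ) (hL : L ≠ 0) (hη : η ≠ 0) (hD : D ≠ 0)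
    (hDe : D = 1 - e * c) (h1 : e ^ 2 + η ^ 2 = 1) (h2 : s ^ 2 + c ^ 2 = 1) :
    s / (L ^ 2 * D) * (- L ^ 2) - (- s * c / (L * D ^ 2)) * (2 * L * (c - e))
       + (-η * c / (L ^ 2 * D)) * (L ^ 2 * (- e / η) * s) - (((- e / η) * c * D + η * c ^ 2) / (L * D ^ 2)) * (2 * L * η * s) = - s := by
  field_simp
  clear hL hη hD
  subst hDe
  have h1' : η ^ 2 = 1 - e ^ 2 := by linarith
  have h2' : s ^ 2 = 1 - c ^ 2 := by linarith
  clear h1 h2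
  grind
lemma dl_ceu (L e η c s D : ℝ) (hL : L ≠ 0) (hη : η ≠ 0) (hD : D ≠ 0)
    (hDe : D = 1 - e * c) (h1 : e ^ 2 + η ^ 2 = 1) (h2 : s ^ 2 + c ^ 2 = 1) :
    (- s * c / (L * D ^ 2)) * (- L ^ 2 * s) - (-(c - e) / (L * D ^ 2)) * (- L ^ 2)
       + (((- e / η) * c * D + η * c ^ 2) / (L * D ^ 2)) * (L ^ 2 * η * c) - (-η * s / (L * D ^ 2)) * (L ^ 2 * (- e / η) * s) = 0 := by
  field_simp
  clear hL hη hD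
  subst hDe
  have h1' : η ^ 2 = 1 - e ^ 2 := by linarith
  have h2' : s ^ 2 = 1 - c ^ 2 := by linarith
  clear h1 h2
  grind
lemma dl_aL (L e η c s D : ℝ) (hL : L ≠ 0) (hη : η ≠ 0) (hD : D ≠ 0)
    (hDe : D = 1 - e * c) (h1 : e ^ 2 + η ^ 2 = 1) (h2 : s ^ 2 + c ^ 2 = 1) :
    (L ^ 2 * (c - e)) * (-η * c / (L ^ 2 * D)) - (L ^ 2 * η * s) * (s / (L ^ 2 * D)) + (2 * L * (c - e)) * (η * c / (L * D)) - (2 * L * η * s) * (- s / (L * D)) = η := by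
  field_simp
  clear hL hη hD
  subst hDe
  have h1' : η ^ 2 = 1 - e ^ 2 := by linarith
  have h2' : s ^ 2 = 1 - c ^ 2 := by linarith
  clear h1 h2
  grind
lemma dl_ae (L e η c s D : ℝ) (hL : L ≠ 0) (hη : η ≠ 0) (hD : D ≠ 0)
    (hDe : D = 1 - e * c) (h1 : e ^ 2 + η ^ 2 = 1) (h2 : s ^ 2 + c ^ 2 = 1) :
    (L ^ 2 * (c - e)) * (((- e / η) * c * D + η * c ^ 2) / (L * D ^ 2)) - (L ^ 2 * η * s) * (- s * c / (L * D ^ 2)) + (- L ^ 2) * (η * c / (L * D)) - (L ^ 2 * (- e / η) * s) * (- s / (L * D)) = L * (- e / η) := by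
  field_simp
  clear hL hη hD
  subst hDe
  have h1' : η ^ 2 = 1 - e ^ 2 := by linarith
  have h2' : s ^ 2 = 1 - c ^ 2 := by linarith
  clear h1 h2
  grind
lemma dl_au (L e η c s D : ℝ) (hL : L ≠ 0) (hη : η ≠ 0) (hD : D ≠ 0)
    (hDe : D = 1 - e * c) (h1 : e ^ 2 + η ^ 2 = 1) (h2 : s ^ 2 + c ^ 2 = 1) :
    (L ^ 2 * (c - e)) * (-η * s / (L * D ^ 2)) - (L ^ 2 * η * s) * (-(c - e) / (L * D ^ 2)) + (- L ^ 2 * s) * (η * c / (L * D)) - (L ^ 2 * η * c) * (- s / (L * D)) = 0 := by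
  field_simp
  clear hL hη hD
  subst hDe
  have h1' : η ^ 2 = 1 - e ^ 2 := by linarith
  have h2' : s ^ 2 = 1 - c ^ 2 := by linarith
  clear h1 h2
  grind
/-- algebra -/
lemma symp_alg (L e η c s D : ℝ) (hL : L ≠ 0) (hη : η ≠ 0) (hD : D ≠ 0)
    (hDe : D = 1 - e * c) (h1 : e ^ 2 + η ^ 2 = 1) (h2 : s ^ 2 + c ^ 2 = 1)
    (C S : ℝ) (h3 : S ^ 2 + C ^ 2 = 1)
    (x y px py : ℝ) (hx : x = L ^ 2 * (c - e)) (hy : y = L ^ 2 * η * s)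
    (hpx : px = - s / (L * D)) (hpy : py = η * c / (L * D))
    (L1 l1 e1 η1 u1 G1 g1 x1 y1 px1 py1 : ℝ)
    (hG1 : G1 = L1 * η + L * η1) (he1 : η1 = - e * e1 / η) (hl1 : l1 = D * u1 - s * e1)
    (hx1 : x1 = 2 * L * L1 * (c - e) + L ^ 2 * (- s * u1 - e1))
    (hy1 : y1 = 2 * L * L1 * η * s + L ^ 2 * (η1 * s + η * c * u1))
    (hpx1 : px1 = s * L1 / (L ^ 2 * D) - s * c * e1 / (L * D ^ 2) - (c - e) * u1 / (L * D ^ 2))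
    (hpy1 : py1 = - η * c * L1 / (L ^ 2 * D) + (η1 * c * D + η * c ^ 2 * e1) / (L * D ^ 2) - η * s * u1 / (L * D ^ 2))
    (L2 l2 e2 η2 u2 G2 g2 x2 y2 px2 py2 : ℝ)
    (hG2 : G2 = L2 * η + L * η2) (he2 : η2 = - e * e2 / η) (hl2 : l2 = D * u2 - s * e2)
    (hx2 : x2 = 2 * L * L2 * (c - e) + L ^ 2 * (- s * u2 - e2))
    (hy2 : y2 = 2 * L * L2 * η * s + L ^ 2 * (η2 * s + η * c * u2))
    (hpx2 : px2 = s * L2 / (L ^ 2 * D) - s * c * e2 / (L * D ^ 2) - (c - e) * u2 / (L * D ^ 2))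
    (hpy2 : py2 = - η * c * L2 / (L ^ 2 * D) + (η2 * c * D + η * c ^ 2 * e2) / (L * D ^ 2) - η * s * u2 / (L * D ^ 2)) :
    ((C * px1 - S * py1) + g1 * (- S * px - C * py)) * ((C * x2 - S * y2) + g2 * (- S * x - C * y))
    - ((C * px2 - S * py2) + g2 * (- S * px - C * py)) * ((C * x1 - S * y1) + g1 * (- S * x - C * y))
    + ((S * px1 + C * py1) + g1 * (C * px - S * py)) * ((S * x2 + C * y2) + g2 * (C * x - S * y))
    - ((S * px2 + C * py2) + g2 * (C * px - S * py)) * ((S * x1 + C * y1) + g1 * (C * x - S * y))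
    = L1 * l2 - L2 * l1 + G1 * g2 - G2 * g1 := by
  have rot : ((C * px1 - S * py1) + g1 * (- S * px - C * py)) * ((C * x2 - S * y2) + g2 * (- S * x - C * y))
    - ((C * px2 - S * py2) + g2 * (- S * px - C * py)) * ((C * x1 - S * y1) + g1 * (- S * x - C * y))
    + ((S * px1 + C * py1) + g1 * (C * px - S * py)) * ((S * x2 + C * y2) + g2 * (C * x - S * y))
    - ((S * px2 + C * py2) + g2 * (C * px - S * py)) * ((S * x1 + C * y1) + g1 * (C * x - S * y))
    = (px1 * x2 - px2 * x1 + py1 * y2 - py2 * y1)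
      + g2 * (x * py1 - y * px1 + x1 * py - y1 * px)
      - g1 * (x * py2 - y * px2 + x2 * py - y2 * px) := by
    linear_combination ((px1 * x2 - px2 * x1 + py1 * y2 - py2 * y1)
      + g2 * (x * py1 - y * px1 + x1 * py - y1 * px)
      - g1 * (x * py2 - y * px2 + x2 * py - y2 * px)) * h3
  have ang1 : x * py1 - y * px1 + x1 * py - y1 * px = G1 := by
    subst hG1 hx1 hy1 hpx1 hpy1 hx hy hpx hpy he1
    linear_combination L1 * dl_aL L e η c s D hL hη hD hDe h1 h2 + e1 * dl_ae L e η c s D hL hη hD hDe h1 h2 + u1 * dl_au L e η c s D hL hη hD hDe h1 h2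
  have ang2 : x * py2 - y * px2 + x2 * py - y2 * px = G2 := by
    subst hG2 hx2 hy2 hpx2 hpy2 hx hy hpx hpy he2
    linear_combination L2 * dl_aL L e η c s D hL hη hD hDe h1 h2 + e2 * dl_ae L e η c s D hL hη hD hDe h1 h2 + u2 * dl_au L e η c s D hL hη hD hDe h1 h2
  have pl : px1 * x2 - px2 * x1 + py1 * y2 - py2 * y1 = L1 * l2 - L2 * l1 := by
    subst hx1 hy1 hpx1 hpy1 he1 hl1 hx2 hy2 hpx2 hpy2 he2 hl2
    linear_combination (L1 * u2 - L2 * u1) * dl_cLu L e η c s D hL hη hD hDe h1 h2 + (L1 * e2 - L2 * e1) * dl_cLe L e η c s D hL hη hD hDe h1 h2 + (e1 * u2 - e2 * u1) * dl_ceu L e η c s D hL hη hD hDe h1 h2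
  rw [rot, ang1, ang2, pl]
  ring
lemma kepler_unique {e a b : ℝ} (h0 : 0 ≤ e) (h1 : e < 1)
    (h : a - e * Real.sin a = b - e * Real.sin b) : a = b := by
  by_contra hne
  have hp : 0 < |a - b| := abs_pos.mpr (sub_ne_zero.mpr hne)
  have h2 : a - b = e * (Real.sin a - Real.sin b) := by linarith
  have h3 : |a - b| = e * |Real.sin a - Real.sin b| := by
    conv_lhs => rw [h2]
    rw [abs_mul, abs_of_nonneg h0]
  have h4 := Real.abs_sin_sub_sin_le a b
  nlinarith

lemma one_sub_ecos_pos {e : ℝ} (h0 : 0 ≤ e) (h1 : e < 1) (u : ℝ) : 0 < 1 - e * Real.cos u := by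
  nlinarith [Real.cos_le_one u]

/-- Kepler's map. -/
noncomputable def keplerMap (p : ℝ × ℝ) : ℝ × ℝ := (p.1, p.2 - p.1 * Real.sin p.2)

/-- The derivative of Kepler's map as an equivalence. -/
noncomputable def keplerEquiv (D s : ℝ) (hD : D ≠ 0) : (ℝ × ℝ) ≃L[ℝ] (ℝ × ℝ) :=
  ContinuousLinearEquiv.equivOfInverse
    ((ContinuousLinearMap.fst ℝ ℝ ℝ).prod
      (D • ContinuousLinearMap.snd ℝ ℝ ℝ - s • ContinuousLinearMap.fst ℝ ℝ ℝ))
    ((ContinuousLinearMap.fst ℝ ℝ ℝ).prod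
      (D⁻¹ • (ContinuousLinearMap.snd ℝ ℝ ℝ + s • ContinuousLinearMap.fst ℝ ℝ ℝ)))
    (by
      intro p
      ext
      · simp
      · simp
        field_simp
        ring)
    (by
      intro p
      ext
      · simp
      · simp
        field_simp
        ring)

lemma kepler_smooth (U : ℝ → ℝ → ℝ)
    (hU : ∀ e ∈ Set.Ico (0:ℝ) 1, ∀ ℓ : ℝ, U e ℓ - e * Real.sin (U e ℓ) = ℓ)
    (e ℓ : ℝ) (h0 : 0 < e) (h1 : e < 1) :
    ContDiffAt ℝ (⊤ : ℕ∞) (fun p : ℝ × ℝ => U p.1 p.2) (e, ℓ) := by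
  have hD := (one_sub_ecos_pos h0.le h1 (U e ℓ)).ne'
  have hf : ContDiffAt ℝ (⊤ : ℕ∞) keplerMap (e, U e ℓ) := by
    unfold keplerMap
    fun_prop
  have hf' : HasFDerivAt keplerMap
      (keplerEquiv (1 - e * Real.cos (U e ℓ)) (Real.sin (U e ℓ)) hD : ℝ × ℝ →L[ℝ] ℝ × ℝ)
      (e, U e ℓ) := by
    have ha : HasFDerivAt (fun p : ℝ × ℝ => p.1) (ContinuousLinearMap.fst ℝ ℝ ℝ) (e, U e ℓ) :=
      hasFDerivAt_fst
    have hb : HasFDerivAt (fun p : ℝ × ℝ => p.2) (ContinuousLinearMap.snd ℝ ℝ ℝ) (e, U e ℓ) :=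
      hasFDerivAt_snd
    have := ha.prodMk (hb.sub (ha.mul hb.sin))
    refine this.congr_fderiv ?_
    ext <;> simp [keplerEquiv] <;> ring
  have hn : ((⊤ : ℕ∞) : WithTop ℕ∞) ≠ 0 := by simp
  have himg : keplerMap (e, U e ℓ) = (e, ℓ) := by
    simp [keplerMap, hU e ⟨h0.le, h1⟩ ℓ]
  have hs := hf.to_localInverse hf' hn
  have hr := (hf.hasStrictFDerivAt' hf' hn).eventually_right_inverse
  rw [himg] at hs hr
  have hs2 := contDiffAt_snd.comp _ hs
  refine hs2.congr_of_eventuallyEq ?_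
  have hopen : ∀ᶠ p : ℝ × ℝ in nhds (e, ℓ), p.1 ∈ Set.Ioo (0:ℝ) 1 :=
    continuousAt_fst.eventually (isOpen_Ioo.mem_nhds ⟨h0, h1⟩)
  filter_upwards [hr, hopen] with p hp hp1
  change keplerMap (hf.localInverse hf' hn p) = p at hp
  have e1 : (hf.localInverse hf' hn p).1 = p.1 := by
    have := congrArg Prod.fst hp
    exact this
  have e2 : (hf.localInverse hf' hn p).2
      - (hf.localInverse hf' hn p).1 * Real.sin (hf.localInverse hf' hn p).2 = p.2 := by
    have := congrArg Prod.snd hp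
    exact this
  rw [e1] at e2
  refine kepler_unique hp1.1.le hp1.2 ?_
  rw [hU p.1 ⟨hp1.1.le, hp1.2⟩ p.2]
  exact e2.symm

/-- eccentricity -/
noncomputable def dE (z : Fin 4 → ℝ) : ℝ := Real.sqrt (1 - (z 2 / z 0) ^ 2)

lemma dE_facts {z : Fin 4 → ℝ} (hz : 0 < z 2 ∧ z 2 < z 0) :
    0 < z 0 ∧ 0 < z 2 / z 0 ∧ 0 < 1 - (z 2 / z 0) ^ 2 ∧ 0 < dE z ∧ dE z < 1 ∧
      dE z ^ 2 + (z 2 / z 0) ^ 2 = 1 := by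
  have hL : 0 < z 0 := hz.1.trans hz.2
  have hη : 0 < z 2 / z 0 := div_pos hz.1 hL
  have hη1 : z 2 / z 0 < 1 := (div_lt_one hL).mpr hz.2
  have hp : 0 < 1 - (z 2 / z 0) ^ 2 := by nlinarith
  have he : 0 < dE z := Real.sqrt_pos.mpr hp
  have hsq : dE z ^ 2 = 1 - (z 2 / z 0) ^ 2 := Real.sq_sqrt hp.le
  refine ⟨hL, hη, hp, he, ?_, by linarith⟩
  nlinarith

/-- eccentric anomaly -/
noncomputable def dU (U : ℝ → ℝ → ℝ) (z : Fin 4 → ℝ) : ℝ := U (dE z) (z 1)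

/-- first simplified planar coordinate -/
noncomputable def fX (L e u : ℝ) : ℝ := L ^ 2 * (Real.cos u - e)
/-- second simplified planar coordinate -/
noncomputable def fY (L η u : ℝ) : ℝ := L ^ 2 * η * Real.sin u
/-- first simplified planar momentum -/
noncomputable def fPX (L e u : ℝ) : ℝ := - Real.sin u / (L * (1 - e * Real.cos u))
/-- second simplified planar momentum -/
noncomputable def fPY (L η e u : ℝ) : ℝ := η * Real.cos u / (L * (1 - e * Real.cos u))

/-- Simplified form of the transformation. -/
noncomputable def simpF (U : ℝ → ℝ → ℝ) (z : Fin 4 → ℝ) : Fin 4 → ℝ :=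
  ![Real.cos (z 3) * fX (z 0) (dE z) (dU U z) - Real.sin (z 3) * fY (z 0) (z 2 / z 0) (dU U z),
    Real.sin (z 3) * fX (z 0) (dE z) (dU U z) + Real.cos (z 3) * fY (z 0) (z 2 / z 0) (dU U z),
    Real.cos (z 3) * fPX (z 0) (dE z) (dU U z)
      - Real.sin (z 3) * fPY (z 0) (z 2 / z 0) (dE z) (dU U z),
    Real.sin (z 3) * fPX (z 0) (dE z) (dU U z)
      + Real.cos (z 3) * fPY (z 0) (z 2 / z 0) (dE z) (dU U z)]

lemma pX_id (L η e c s : ℝ) (hL : L ≠ 0) (hD : 1 - e * c ≠ 0) (h1 : e ^ 2 + η ^ 2 = 1)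
    (_ : s ^ 2 + c ^ 2 = 1) :
    e * s / (L * (1 - e * c)) * ((c - e) / (1 - e * c))
      - (η * L) / (L ^ 2 * (1 - e * c)) * (η * s / (1 - e * c)) = - s / (L * (1 - e * c)) := by
  have h1' : η ^ 2 = 1 - e ^ 2 := by linarith
  field_simp
  rw [h1']
  ring

lemma pY_id (L η e c s : ℝ) (hL : L ≠ 0) (hD : 1 - e * c ≠ 0) (h1 : e ^ 2 + η ^ 2 = 1)
    (h2 : s ^ 2 + c ^ 2 = 1) :
    e * s / (L * (1 - e * c)) * (η * s / (1 - e * c))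
      + (η * L) / (L ^ 2 * (1 - e * c)) * ((c - e) / (1 - e * c)) = η * c / (L * (1 - e * c)) := by
  have h2' : s ^ 2 = 1 - c ^ 2 := by linarith
  field_simp
  rw [h2']
  ring

lemma delaunayF_eq (U : ℝ → ℝ → ℝ) {z : Fin 4 → ℝ} (hz : 0 < z 2 ∧ z 2 < z 0) :
    delaunayF U z = simpF U z := by
  obtain ⟨hL, hη, hp, he, he1, hsq⟩ := dE_facts hz
  have hD := (one_sub_ecos_pos he.le he1 (dU U z)).ne'
  have hE : Real.sqrt (1 - z 2 ^ 2 / z 0 ^ 2) = dE z := by rw [dE, div_pow]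
  have hη' : Real.sqrt (1 - dE z ^ 2) = z 2 / z 0 := by
    rw [show 1 - dE z ^ 2 = (z 2 / z 0) ^ 2 by linarith]
    exact Real.sqrt_sq hη.le
  have hG : z 2 = z 2 / z 0 * z 0 := by field_simp
  have hx := pX_id (z 0) (z 2 / z 0) (dE z) (Real.cos (dU U z)) (Real.sin (dU U z)) hL.ne' hD hsq
    (Real.sin_sq_add_cos_sq _)
  have hy := pY_id (z 0) (z 2 / z 0) (dE z) (Real.cos (dU U z)) (Real.sin (dU U z)) hL.ne' hD hsq
    (Real.sin_sq_add_cos_sq _)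
  rw [← hG] at hx hy
  unfold delaunayF simpF fX fY fPX fPY
  simp only [hE, hη']
  change _ = _
  have hUU : U (dE z) (z 1) = dU U z := rfl
  simp only [hUU]
  rw [← hx, ← hy]
  ext i
  fin_cases i
  · simp; field_simp
  · simp; field_simp; ring
  · simp; ring
  · simp; ring

lemma dE_smooth {z : Fin 4 → ℝ} (hz : 0 < z 2 ∧ z 2 < z 0) :
    ContDiffAt ℝ (⊤ : ℕ∞) dE z := by
  obtain ⟨hL, hη, hp, he, he1, hsq⟩ := dE_facts hz
  unfold dE
  refine ContDiffAt.sqrt ?_ hp.ne'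
  have : z 0 ≠ 0 := hL.ne'
  fun_prop (disch := assumption)

lemma dU_smooth (U : ℝ → ℝ → ℝ)
    (hU : ∀ e ∈ Set.Ico (0:ℝ) 1, ∀ ℓ : ℝ, U e ℓ - e * Real.sin (U e ℓ) = ℓ)
    {z : Fin 4 → ℝ} (hz : 0 < z 2 ∧ z 2 < z 0) :
    ContDiffAt ℝ (⊤ : ℕ∞) (dU U) z := by
  obtain ⟨hL, hη, hp, he, he1, hsq⟩ := dE_facts hz
  have h := kepler_smooth U hU (dE z) (z 1) he he1
  have h1 : ContDiffAt ℝ (⊤ : ℕ∞) (fun z : Fin 4 → ℝ => z 1) z := by fun_prop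
  exact ContDiffAt.comp z h ((dE_smooth hz).prodMk h1)

lemma simpF_smooth (U : ℝ → ℝ → ℝ)
    (hU : ∀ e ∈ Set.Ico (0:ℝ) 1, ∀ ℓ : ℝ, U e ℓ - e * Real.sin (U e ℓ) = ℓ)
    {z : Fin 4 → ℝ} (hz : 0 < z 2 ∧ z 2 < z 0) :
    ContDiffAt ℝ (⊤ : ℕ∞) (simpF U) z := by
  obtain ⟨hL, hη, hp, he, he1, hsq⟩ := dE_facts hz
  have hD := (one_sub_ecos_pos he.le he1 (dU U z)).ne'
  have h1 := dE_smooth hz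
  have h2 := dU_smooth U hU hz
  have h0 : z 0 ≠ 0 := hL.ne'
  have h3 : z 0 * (1 - dE z * Real.cos (dU U z)) ≠ 0 := mul_ne_zero h0 hD
  rw [contDiffAt_pi]
  intro i
  fin_cases i <;> simp [simpF, fX, fY, fPX, fPY] <;> fun_prop (disch := assumption)

lemma dom_open : IsOpen {z : Fin 4 → ℝ | 0 < z 2 ∧ z 2 < z 0} := by
  refine IsOpen.inter ?_ ?_
  · exact isOpen_lt continuous_const (continuous_apply 2)
  · exact isOpen_lt (continuous_apply 2) (continuous_apply 0)

lemma px_alg (L e c s v e1 u1 : ℝ) (hL : L ≠ 0) (hD : 1 - e * c ≠ 0) (h2 : s ^ 2 + c ^ 2 = 1) :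
    (-(c * u1) * (L * (1 - e * c)) - (-s) * (v * (1 - e * c) + L * (0 - (e1 * c + e * (-s * u1)))))
      / (L * (1 - e * c)) ^ 2
    = s * v / (L ^ 2 * (1 - e * c)) - s * c * e1 / (L * (1 - e * c) ^ 2)
      - (c - e) * u1 / (L * (1 - e * c) ^ 2) := by
  have h2' : s ^ 2 = 1 - c ^ 2 := by linarith
  field_simp
  ring_nf
  rw [h2']
  ring

lemma py_alg (L e η c s v e1 η1 u1 : ℝ) (hL : L ≠ 0) (hD : 1 - e * c ≠ 0) :
    ((η1 * c + η * (-s * u1)) * (L * (1 - e * c))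
        - (η * c) * (v * (1 - e * c) + L * (0 - (e1 * c + e * (-s * u1)))))
      / (L * (1 - e * c)) ^ 2
    = - η * c * v / (L ^ 2 * (1 - e * c))
      + (η1 * c * (1 - e * c) + η * c ^ 2 * e1) / (L * (1 - e * c) ^ 2)
      - η * s * u1 / (L * (1 - e * c) ^ 2) := by
  field_simp
  ring

/-- Directional derivative data. -/
lemma deriv_data (U : ℝ → ℝ → ℝ)
    (hU : ∀ e ∈ Set.Ico (0:ℝ) 1, ∀ ℓ : ℝ, U e ℓ - e * Real.sin (U e ℓ) = ℓ)
    {z : Fin 4 → ℝ} (hz : 0 < z 2 ∧ z 2 < z 0) (v : Fin 4 → ℝ) :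
    ∃ e1 η1 u1 x1 y1 px1 py1 : ℝ,
      v 2 = v 0 * (z 2 / z 0) + z 0 * η1 ∧
      η1 = - dE z * e1 / (z 2 / z 0) ∧
      v 1 = (1 - dE z * Real.cos (dU U z)) * u1 - Real.sin (dU U z) * e1 ∧
      x1 = 2 * z 0 * v 0 * (Real.cos (dU U z) - dE z) + z 0 ^ 2 * (- Real.sin (dU U z) * u1 - e1) ∧
      y1 = 2 * z 0 * v 0 * (z 2 / z 0) * Real.sin (dU U z)
        + z 0 ^ 2 * (η1 * Real.sin (dU U z) + (z 2 / z 0) * Real.cos (dU U z) * u1) ∧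
      px1 = Real.sin (dU U z) * v 0 / (z 0 ^ 2 * (1 - dE z * Real.cos (dU U z)))
        - Real.sin (dU U z) * Real.cos (dU U z) * e1 / (z 0 * (1 - dE z * Real.cos (dU U z)) ^ 2)
        - (Real.cos (dU U z) - dE z) * u1 / (z 0 * (1 - dE z * Real.cos (dU U z)) ^ 2) ∧
      py1 = - (z 2 / z 0) * Real.cos (dU U z) * v 0 / (z 0 ^ 2 * (1 - dE z * Real.cos (dU U z)))
        + (η1 * Real.cos (dU U z) * (1 - dE z * Real.cos (dU U z))
          + (z 2 / z 0) * Real.cos (dU U z) ^ 2 * e1)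
            / (z 0 * (1 - dE z * Real.cos (dU U z)) ^ 2)
        - (z 2 / z 0) * Real.sin (dU U z) * u1 / (z 0 * (1 - dE z * Real.cos (dU U z)) ^ 2) ∧
      fderiv ℝ (delaunayF U) z v 0 = (Real.cos (z 3) * x1 - Real.sin (z 3) * y1)
        + v 3 * (- Real.sin (z 3) * fX (z 0) (dE z) (dU U z)
          - Real.cos (z 3) * fY (z 0) (z 2 / z 0) (dU U z)) ∧
      fderiv ℝ (delaunayF U) z v 1 = (Real.sin (z 3) * x1 + Real.cos (z 3) * y1)
        + v 3 * (Real.cos (z 3) * fX (z 0) (dE z) (dU U z)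
          - Real.sin (z 3) * fY (z 0) (z 2 / z 0) (dU U z)) ∧
      fderiv ℝ (delaunayF U) z v 2 = (Real.cos (z 3) * px1 - Real.sin (z 3) * py1)
        + v 3 * (- Real.sin (z 3) * fPX (z 0) (dE z) (dU U z)
          - Real.cos (z 3) * fPY (z 0) (z 2 / z 0) (dE z) (dU U z)) ∧
      fderiv ℝ (delaunayF U) z v 3 = (Real.sin (z 3) * px1 + Real.cos (z 3) * py1)
        + v 3 * (Real.cos (z 3) * fPX (z 0) (dE z) (dU U z)
          - Real.sin (z 3) * fPY (z 0) (z 2 / z 0) (dE z) (dU U z)) := by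
  obtain ⟨hL, hη, hp, he, he1, hsq⟩ := dE_facts hz
  have hD := (one_sub_ecos_pos he.le he1 (dU U z)).ne'
  have hmem : {z : Fin 4 → ℝ | 0 < z 2 ∧ z 2 < z 0} ∈ nhds z := dom_open.mem_nhds hz
  have hn : ((⊤ : ℕ∞) : WithTop ℕ∞) ≠ 0 := by simp
  -- the line through z
  have hline : HasDerivAt (fun t : ℝ => z + t • v) v 0 := by
    simpa using ((hasDerivAt_id (0:ℝ)).smul_const v).const_add z
  have hz0 : z + (0:ℝ) • v = z := by simp
  have hco : ∀ i, HasDerivAt (fun t : ℝ => (z + t • v) i) (v i) 0 := hasDerivAt_pi.mp hline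
  have along : ∀ f : (Fin 4 → ℝ) → ℝ, DifferentiableAt ℝ f z →
      HasDerivAt (fun t : ℝ => f (z + t • v)) (fderiv ℝ f z v) 0 := by
    intro f hf
    have h : HasFDerivAt f (fderiv ℝ f z) (z + (0:ℝ) • v) := by rw [hz0]; exact hf.hasFDerivAt
    exact h.comp_hasDerivAt 0 hline
  have hEd := along dE ((dE_smooth hz).differentiableAt hn)
  have hUd := along (dU U) ((dU_smooth U hU hz).differentiableAt hn)
  have hev : ∀ᶠ t : ℝ in nhds 0, 0 < (z + t • v) 2 ∧ (z + t • v) 2 < (z + t • v) 0 := by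
    have hc := hline.continuousAt
    have : {z : Fin 4 → ℝ | 0 < z 2 ∧ z 2 < z 0} ∈ nhds (z + (0:ℝ) • v) := by rwa [hz0]
    exact hc this
  set e1 := fderiv ℝ dE z v with he1d
  set u1 := fderiv ℝ (dU U) z v with hu1d
  have hηd := (hco 2).div (hco 0) (by simpa using hL.ne')
  simp only [hz0] at hηd
  set η1 := (v 2 * z 0 - z 2 * v 0) / z 0 ^ 2 with hη1d
  have hFd : DifferentiableAt ℝ (delaunayF U) z := by
    have h := (simpF_smooth U hU hz).differentiableAt hn
    refine h.congr_of_eventuallyEq ?_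
    filter_upwards [hmem] with w hw using delaunayF_eq U hw
  have hF : ∀ i, HasDerivAt (fun t : ℝ => simpF U (z + t • v) i) (fderiv ℝ (delaunayF U) z v i) 0 := by
    intro i
    have h : HasFDerivAt (delaunayF U) (fderiv ℝ (delaunayF U) z) (z + (0:ℝ) • v) := by
      rw [hz0]; exact hFd.hasFDerivAt
    have h2 := hasDerivAt_pi.mp (h.comp_hasDerivAt 0 hline) i
    refine h2.congr_of_eventuallyEq ?_
    filter_upwards [hev] with t ht
    simp [delaunayF_eq U ht]
  -- derivative relations
  have r1 : dE z * e1 + (z 2 / z 0) * η1 = 0 := by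
    have h := (hEd.pow 2).add (hηd.pow 2)
    have hc : HasDerivAt (fun _ : ℝ => (1:ℝ)) 0 0 := hasDerivAt_const _ _
    have h' := h.unique (hc.congr_of_eventuallyEq (by
      filter_upwards [hev] with t ht
      exact (dE_facts ht).2.2.2.2.2))
    simp only [hz0] at h'
    norm_num at h'
    linarith
  have r2 : v 1 = (1 - dE z * Real.cos (dU U z)) * u1 - Real.sin (dU U z) * e1 := by
    have h := hUd.sub (hEd.mul hUd.sin)
    have h' := h.unique ((hco 1).congr_of_eventuallyEq (by
      filter_upwards [hev] with t ht
      have hf := dE_facts ht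
      exact hU _ ⟨hf.2.2.2.1.le, hf.2.2.2.2.1⟩ _))
    simp only [hz0] at h'
    linarith
  have hDd := (hasDerivAt_const (0:ℝ) (1:ℝ)).sub (hEd.mul hUd.cos)
  have hX := ((hco 0).pow 2).mul (hUd.cos.sub hEd)
  have hY := (((hco 0).pow 2).mul hηd).mul hUd.sin
  have hLD := (hco 0).mul hDd
  have hne : z 0 * (1 - dE z * Real.cos (dU U z)) ≠ 0 := mul_ne_zero hL.ne' hD
  have hPX := hUd.sin.neg.div hLD (by simpa [hz0] using! hne)
  have hPY := (hηd.mul hUd.cos).div hLD (by simpa [hz0] using! hne)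
  have hpxa := px_alg (z 0) (dE z) (Real.cos (dU U z)) (Real.sin (dU U z)) (v 0) e1 u1 hL.ne' hD
    (Real.sin_sq_add_cos_sq _)
  have hpya := py_alg (z 0) (dE z) (z 2 / z 0) (Real.cos (dU U z)) (Real.sin (dU U z)) (v 0) e1 η1
    u1 hL.ne' hD
  have hPX' := hPX.congr_deriv (by
    simp only [Pi.mul_apply, Pi.sub_apply, Pi.neg_apply, Pi.div_apply, hz0]
    exact hpxa)
  have hPY' := hPY.congr_deriv (by
    simp only [Pi.mul_apply, Pi.sub_apply, Pi.neg_apply, Pi.div_apply, hz0]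
    exact hpya)
  have hC := (hco 3).cos
  have hS := (hco 3).sin
  refine ⟨e1, η1, u1, _, _, _, _, ?_, ?_, r2, rfl, rfl, rfl, rfl, ?_, ?_, ?_, ?_⟩
  · rw [hη1d]; field_simp; ring
  · rw [eq_div_iff hη.ne']; linarith
  · have h := (hF 0).unique ((hC.mul hX).sub (hS.mul hY))
    rw [h]
    simp [hz0, fX, fY]
    ring
  · have h := (hF 1).unique ((hS.mul hX).add (hC.mul hY))
    rw [h]
    simp [hz0, fX, fY]
    ring
  · have h := (hF 2).unique ((hC.mul hPX').sub (hS.mul hPY'))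
    rw [h]
    simp only [Pi.mul_apply, Pi.sub_apply, Pi.neg_apply, Pi.div_apply, hz0, fPX, fPY]
    ring
  · have h := (hF 3).unique ((hS.mul hPX').add (hC.mul hPY'))
    rw [h]
    simp only [Pi.mul_apply, Pi.sub_apply, Pi.neg_apply, Pi.div_apply, hz0, fPX, fPY]
    ring

lemma symp_form (U : ℝ → ℝ → ℝ)
    (hU : ∀ e ∈ Set.Ico (0:ℝ) 1, ∀ ℓ : ℝ, U e ℓ - e * Real.sin (U e ℓ) = ℓ)
    {z : Fin 4 → ℝ} (hz : 0 < z 2 ∧ z 2 < z 0) (v w : Fin 4 → ℝ) :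
    fderiv ℝ (delaunayF U) z v 2 * fderiv ℝ (delaunayF U) z w 0
      - fderiv ℝ (delaunayF U) z w 2 * fderiv ℝ (delaunayF U) z v 0
      + fderiv ℝ (delaunayF U) z v 3 * fderiv ℝ (delaunayF U) z w 1
      - fderiv ℝ (delaunayF U) z w 3 * fderiv ℝ (delaunayF U) z v 1
    = v 0 * w 1 - w 0 * v 1 + v 2 * w 3 - w 2 * v 3 := by
  obtain ⟨hL, hη, hp, he, he1, hsq⟩ := dE_facts hz
  have hD := (one_sub_ecos_pos he.le he1 (dU U z)).ne'
  obtain ⟨e1, η1, u1, x1, y1, px1, py1, a1, a2, a3, a4, a5, a6, a7, a8, a9, a10, a11⟩ :=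
    deriv_data U hU hz v
  obtain ⟨e2, η2, u2, x2, y2, px2, py2, b1, b2, b3, b4, b5, b6, b7, b8, b9, b10, b11⟩ :=
    deriv_data U hU hz w
  rw [a8, a9, a10, a11, b8, b9, b10, b11]
  exact symp_alg (z 0) (dE z) (z 2 / z 0) (Real.cos (dU U z)) (Real.sin (dU U z)) _ hL.ne' hη.ne' hD
    rfl hsq (Real.sin_sq_add_cos_sq _) _ _ (Real.sin_sq_add_cos_sq _) _ _ _ _ rfl rfl rfl rfl
    (v 0) (v 1) e1 η1 u1 (v 2) (v 3) x1 y1 px1 py1 a1 a2 a3 a4 a5 a6 a7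
    (w 0) (w 1) e2 η2 u2 (w 2) (w 3) x2 y2 px2 py2 b1 b2 b3 b4 b5 b6 b7

/-- The Delaunay transformation is symplectic: it is `C^∞`
on `D = {0 < G < L}`, and its Jacobian pulls the canonical form
`dp₁∧dq₁ + dp₂∧dq₂` back to `dL∧dℓ + dG∧dg`, i.e.
`(DF(z))ᵀ · Ω · DF(z) = Ω₀` on `D`. -/
theorem stmt_17 (U : ℝ → ℝ → ℝ)
    (hU : ∀ e ∈ Set.Ico (0:ℝ) 1, ∀ ℓ : ℝ, U e ℓ - e * Real.sin (U e ℓ) = ℓ) :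
    ContDiffOn ℝ (⊤ : ℕ∞) (delaunayF U) {z : Fin 4 → ℝ | 0 < z 2 ∧ z 2 < z 0} ∧
    ∀ z ∈ {z : Fin 4 → ℝ | 0 < z 2 ∧ z 2 < z 0},
      (delaunayJac U z).transpose * OmegaQP * delaunayJac U z = OmegaDel := by
  constructor
  · intro z hz
    refine ContDiffAt.contDiffWithinAt ?_
    refine (simpF_smooth U hU hz).congr_of_eventuallyEq ?_
    filter_upwards [dom_open.mem_nhds hz] with w hw using delaunayF_eq U hw
  · intro z hz
    have key := symp_form U hU hz
    ext i j
    have hij := key (Pi.single i 1) (Pi.single j 1)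
    have hent : ((delaunayJac U z).transpose * OmegaQP * delaunayJac U z) i j
        = delaunayJac U z 2 i * delaunayJac U z 0 j - delaunayJac U z 2 j * delaunayJac U z 0 i
          + delaunayJac U z 3 i * delaunayJac U z 1 j
          - delaunayJac U z 3 j * delaunayJac U z 1 i := by
      simp [Matrix.mul_apply, Fin.sum_univ_four, OmegaQP]
      ring
    rw [hent]
    simp only [delaunayJac, Matrix.of_apply]
    rw [hij]
    fin_cases i <;> fin_cases j <;> simp [OmegaDel, Pi.single_apply]
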